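/- The invariant F_N is unchanged under unimodular congruence (in particular under the handle-slide Kirby moves on the linking matrix): for every m×m symmetric integer matrix A and every U ∈ GL_m(ℤ), F_N(Uᵀ A U) = F_N(A). -/

import Mathlib

open Finset

noncomputable section

/-- `q = exp(2πi/N)`. -/
def qRoot (N : ℕ) : ℂ := Complex.exp (2 * Real.pi * Complex.I / N)

/-- The Gauss sum `G_k = Σ_{ν=0}^{N-1} q^{kν²}`. -/
def gauss (N : ℕ) (k : ℤ) : ℂ := ∑ ν ∈ range N, qRoot N ^ (k * (ν : ℤ) ^ 2)

open scoped Classical in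
/-- `σ(A)`: the number of nonpositive eigenvalues (with multiplicity) of the
symmetric integer matrix `A`, regarded as a real symmetric matrix. -/
def sigmaCount {n : Type*} [Fintype n] [DecidableEq n] (A : Matrix n n ℤ) : ℕ :=
  if h : (A.map (fun x : ℤ => (x : ℝ))).IsHermitian then
    (Finset.univ.filter fun i => h.eigenvalues i ≤ 0).card
  else 0

/-- The three-manifold invariant arising from `U_q(gl(2|1))` at `q = exp(2πi/N)`,
`N = 2r+1`, in the special case where only one-dimensional representations
contribute, as a function of the linking matrix `A` (of size `m = card n`):
`F_N(A) = N^{-m/2}·(G_{N-1}/√N)^{m-2σ(A)}·Σ_{x∈{0,…,N-1}^m} q^{xᵀAx}`. -/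
def FN (r : ℕ) {n : Type*} [Fintype n] [DecidableEq n] (A : Matrix n n ℤ) : ℂ :=
  ((Real.sqrt (2 * r + 1) : ℂ)) ^ (-(Fintype.card n : ℤ)) *
    (gauss (2 * r + 1) ((2 * r + 1 : ℤ) - 1) / (Real.sqrt (2 * r + 1) : ℂ)) ^
      ((Fintype.card n : ℤ) - 2 * (sigmaCount A : ℤ)) *
    ∑ x ∈ Fintype.piFinset (fun _ : n => Finset.range (2 * r + 1)),
      qRoot (2 * r + 1) ^ (∑ i, ∑ j, (x i : ℤ) * A i j * (x j : ℤ))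

/-- A unimodular congruence of matrices is an isometry of the associated quadratic forms. -/
theorem Matrix.equivalent_toQuadraticForm'_congr {R n : Type*} [CommRing R] [Fintype n]
    [DecidableEq n] (M P : Matrix n n R) (hP : IsUnit P.det) :
    QuadraticMap.Equivalent (P.transpose * M * P).toQuadraticForm' M.toQuadraticForm' := by
  have := P.invertibleOfIsUnitDet hP
  refine ⟨⟨P.toLinearEquiv' this, fun x => ?_⟩⟩
  change M.toQuadraticForm' (P.mulVec x) = _
  simp only [Matrix.toQuadraticForm', LinearMap.BilinMap.toQuadraticMap_apply,
    Matrix.toLinearMap₂'_apply']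
  rw [Matrix.mul_assoc, ← Matrix.mulVec_mulVec, ← Matrix.mulVec_mulVec,
    Matrix.dotProduct_mulVec x, Matrix.vecMul_transpose]

/-- A real symmetric matrix is orthogonally equivalent to its eigenvalues, as a quadratic form. -/
theorem Matrix.IsHermitian.equivalent_weightedSumSquares_eigenvalues {n : Type*} [Fintype n]
    [DecidableEq n] {M : Matrix n n ℝ} (hM : M.IsHermitian) :
    QuadraticMap.Equivalent M.toQuadraticForm'
      (QuadraticMap.weightedSumSquares ℝ hM.eigenvalues) := by
  have hdiag : (Matrix.diagonal hM.eigenvalues).toQuadraticForm' =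
      QuadraticMap.weightedSumSquares ℝ hM.eigenvalues := by
    ext x
    simp only [Matrix.toQuadraticForm', LinearMap.BilinMap.toQuadraticMap_apply,
      Matrix.toLinearMap₂'_apply', QuadraticMap.weightedSumSquares_apply, dotProduct,
      Matrix.mulVec_diagonal, smul_eq_mul]
    exact Finset.sum_congr rfl fun i _ => by ring
  have hconj := hM.conjStarAlgAut_star_eigenvectorUnitary
  rw [Unitary.conjStarAlgAut_star_apply] at hconj
  have hdet : IsUnit (hM.eigenvectorUnitary : Matrix n n ℝ).det :=
    (Matrix.isUnit_iff_isUnit_det _).1 (Unitary.toUnits hM.eigenvectorUnitary).isUnit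
  have h := Matrix.equivalent_toQuadraticForm'_congr M (hM.eigenvectorUnitary : Matrix n n ℝ) hdet
  rw [← Matrix.conjTranspose_eq_transpose_of_trivial, ← Matrix.star_eq_conjTranspose, hconj] at h
  exact h.symm.trans (by rw [← hdiag]; exact .refl _)

/-- `σ(A)` is the corank of a maximal positive definite subspace. -/
theorem sigmaCount_add_sigPos {n : Type*} [Fintype n] [DecidableEq n] {A : Matrix n n ℤ}
    (hA : A.IsSymm) :
    sigmaCount A + sigPos (A.map (Int.cast : ℤ → ℝ)).toQuadraticForm' = Fintype.card n := by
  classical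
  have h : (A.map (fun x : ℤ => (x : ℝ))).IsHermitian := by
    ext i j
    simp [hA.apply]
  rw [sigmaCount, dif_pos h, QuadraticForm.sigPos_of_equiv_weightedSumSquares
    h.equivalent_weightedSumSquares_eigenvalues, Set.ncard_eq_toFinset_card']
  simp only [Set.toFinset_ofPred, ← not_le]
  convert! Finset.card_filter_add_card_filter_not (s := Finset.univ) _

/-- `σ` is invariant under unimodular congruence. -/
theorem sigmaCount_congr {n : Type*} [Fintype n] [DecidableEq n] {A : Matrix n n ℤ}
    (hA : A.IsSymm) (U : Matrix n n ℤ) (hU : IsUnit U.det) :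
    sigmaCount (U.transpose * A * U) = sigmaCount A := by
  have hB : (U.transpose * A * U).IsSymm := by
    simp [Matrix.IsSymm, Matrix.transpose_mul, hA.eq, Matrix.mul_assoc]
  have hmap : (U.transpose * A * U).map (Int.cast : ℤ → ℝ) =
      (U.map Int.cast).transpose * A.map Int.cast * U.map Int.cast := by
    simp only [← Int.coe_castRingHom (α := ℝ), Matrix.map_mul, Matrix.transpose_map]
  have hdet : IsUnit (U.map (Int.cast : ℤ → ℝ)).det := by
    have := hU.map (Int.castRingHom ℝ)
    rwa [RingHom.map_det] at this
  have h := sigmaCount_add_sigPos hB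
  rw [hmap, (Matrix.equivalent_toQuadraticForm'_congr _ _ hdet).sigPos_eq] at h
  have := sigmaCount_add_sigPos hA
  omega

/-- Powers of `q` are values of the standard additive character of `ℤ/N`. -/
theorem qRoot_zpow (N : ℕ) [NeZero N] (k : ℤ) : qRoot N ^ k = ZMod.stdAddChar (k : ZMod N) := by
  rw [ZMod.stdAddChar_coe, qRoot, ← Complex.exp_int_mul]
  congr 1
  ring

/-- The sum in `F_N` as a Gauss sum of a quadratic form over `ℤ/N`. -/
theorem sum_qRoot_zpow {n : Type*} [Fintype n] [DecidableEq n] (N : ℕ) [NeZero N]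
    (A : Matrix n n ℤ) :
    ∑ x ∈ Fintype.piFinset (fun _ : n => Finset.range N),
      qRoot N ^ (∑ i, ∑ j, (x i : ℤ) * A i j * (x j : ℤ)) =
    ∑ y : n → ZMod N, ZMod.stdAddChar ((A.map (Int.cast : ℤ → ZMod N)).toQuadraticForm' y) := by
  refine Finset.sum_bij' (fun x _ i => (x i : ZMod N)) (fun y _ i => (y i).val) (by simp)
    (by simp [ZMod.val_lt]) ?_ (by simp) ?_
  · intro x hx
    ext i
    exact ZMod.val_cast_of_lt (by simpa using Fintype.mem_piFinset.1 hx i)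
  · intro x _
    rw [qRoot_zpow]
    simp [Matrix.toQuadraticForm', Matrix.toLinearMap₂'_apply', dotProduct, Matrix.mulVec,
      Finset.mul_sum, mul_assoc]

/-- The Gauss sum of a quadratic form only depends on its congruence class. -/
theorem sum_qRoot_zpow_congr {n : Type*} [Fintype n] [DecidableEq n] (N : ℕ) [NeZero N]
    (A U : Matrix n n ℤ) (hU : IsUnit U.det) :
    ∑ x ∈ Fintype.piFinset (fun _ : n => Finset.range N),
      qRoot N ^ (∑ i, ∑ j, (x i : ℤ) * (U.transpose * A * U) i j * (x j : ℤ)) =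
    ∑ x ∈ Fintype.piFinset (fun _ : n => Finset.range N),
      qRoot N ^ (∑ i, ∑ j, (x i : ℤ) * A i j * (x j : ℤ)) := by
  have hmap : (U.transpose * A * U).map (Int.cast : ℤ → ZMod N) =
      (U.map Int.cast).transpose * A.map Int.cast * U.map Int.cast := by
    simp only [← Int.coe_castRingHom (α := ZMod N), Matrix.map_mul, Matrix.transpose_map]
  have hdet : IsUnit (U.map (Int.cast : ℤ → ZMod N)).det := by
    have := hU.map (Int.castRingHom (ZMod N))
    rwa [RingHom.map_det] at this
  obtain ⟨e⟩ := Matrix.equivalent_toQuadraticForm'_congr (A.map (Int.cast : ℤ → ZMod N)) _ hdet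
  rw [sum_qRoot_zpow, sum_qRoot_zpow, hmap]
  exact Fintype.sum_equiv e.toEquiv _ _ fun y => by
    rw [← e.map_app y]
    rfl

/-- `F_N` is unchanged under unimodular congruence (in particular under the
handle-slide Kirby moves): `F_N(Uᵀ A U) = F_N(A)` for every symmetric integer
matrix `A` and every `U ∈ GL_m(ℤ)`. -/
theorem FN_congruence (r : ℕ) (hr : 1 ≤ r) {m : ℕ}
    (A : Matrix (Fin m) (Fin m) ℤ) (hA : A.IsSymm)
    (U : Matrix (Fin m) (Fin m) ℤ) (hU : IsUnit U.det) :
    FN r (U.transpose * A * U) = FN r A := by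
  rw [FN, FN, sigmaCount_congr hA U hU, sum_qRoot_zpow_congr (2 * r + 1) A U hU]

end
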